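/- arXiv:1204.5070 — 2 statements merged into one kernel-verified Lean document; each statement's English description precedes it below -/
import Mathlib

section
/- For every n with 0 ≤ n ≤ N one has Σ_{k=0}^N p_n(k)·p_n(k−1)·w(k) = 1, and for every n with 1 ≤ n ≤ N one has Σ_{k=0}^N p_n(k)·p_{n−1}(k−1)·w(k) = 0. -/
/-- For orthonormal polynomials with respect to a positive discrete weight on
`{0,…,N}` one has `∑ₖ pₙ(k) pₙ(k-1) w(k) = 1` and `∑ₖ pₙ(k) pₙ₋₁(k-1) w(k) = 0`. -/
theorem orthonormal_shifted_sums
    (N : ℕ) (hN : 1 ≤ N)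
    (w : ℕ → ℝ) (hw : ∀ k, k ≤ N → 0 < w k)
    (p : ℕ → Polynomial ℝ)
    (hdeg : ∀ n, n ≤ N → (p n).natDegree = n)
    (hlead : ∀ n, n ≤ N → 0 < (p n).leadingCoeff)
    (horth : ∀ m, m ≤ N → ∀ n, n ≤ N →
      ∑ k ∈ Finset.range (N + 1), (p m).eval (k : ℝ) * (p n).eval (k : ℝ) * w k
        = if m = n then 1 else 0) :
    (∀ n, n ≤ N →
      ∑ k ∈ Finset.range (N + 1),
        (p n).eval (k : ℝ) * (p n).eval ((k : ℝ) - 1) * w k = 1) ∧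
    (∀ n, 1 ≤ n → n ≤ N →
      ∑ k ∈ Finset.range (N + 1),
        (p n).eval (k : ℝ) * (p (n - 1)).eval ((k : ℝ) - 1) * w k = 0) := by
  have key : ∀ n, n ≤ N → ∀ d, d ≤ n → ∀ q : Polynomial ℝ, q.degree < (d : WithBot ℕ) →
      ∑ k ∈ Finset.range (N + 1), (p n).eval (k : ℝ) * q.eval (k : ℝ) * w k = 0 := by
    intro n hn d
    induction d with
    | zero =>
      intro _ q hq
      have hq0 : q = 0 := by
        ext m
        simpa using (Polynomial.degree_lt_iff_coeff_zero q 0).1 hq m (Nat.zero_le m)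
      simp [hq0]
    | succ d ih =>
      intro hd q hq
      have hdN : d ≤ N := by omega
      have hl := hlead d hdN
      have hlc : (p d).coeff d = (p d).leadingCoeff := by
        rw [Polynomial.leadingCoeff, hdeg d hdN]
      set c : ℝ := q.coeff d / (p d).leadingCoeff with hc
      have hr := ih (by omega) (q - Polynomial.C c * p d) (by
        rw [Polynomial.degree_lt_iff_coeff_zero]
        intro m hm
        rw [Polynomial.coeff_sub, Polynomial.coeff_C_mul]
        rcases Nat.eq_or_lt_of_le hm with h | h
        · subst h
          rw [hlc, hc]
          field_simp
          ring
        · rw [(Polynomial.degree_lt_iff_coeff_zero q (d + 1)).1 hq m h,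
            Polynomial.coeff_eq_zero_of_natDegree_lt (by rw [hdeg d hdN]; exact h)]
          ring)
      have ho := horth n hn d hdN
      rw [if_neg (by omega)] at ho
      calc _ = ∑ k ∈ Finset.range (N + 1),
              (p n).eval (k : ℝ) * (q - Polynomial.C c * p d).eval (k : ℝ) * w k
            + c * ∑ k ∈ Finset.range (N + 1), (p n).eval (k : ℝ) * (p d).eval (k : ℝ) * w k := by
            rw [Finset.mul_sum, ← Finset.sum_add_distrib]
            refine Finset.sum_congr rfl fun k _ => ?_
            simp only [Polynomial.eval_sub, Polynomial.eval_mul, Polynomial.eval_C]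
            ring
        _ = 0 := by rw [hr, ho]; ring
  have hev : ∀ n, ∀ x : ℝ, (Polynomial.taylor (-1) (p n)).eval x = (p n).eval (x - 1) := by
    intro n x
    rw [Polynomial.taylor_eval, sub_eq_add_neg]
  constructor
  · intro n hn
    have h0 := key n hn n le_rfl (Polynomial.taylor (-1) (p n) - p n) (by
      rw [Polynomial.degree_lt_iff_coeff_zero]
      intro m hm
      rw [Polynomial.coeff_sub]
      rcases Nat.eq_or_lt_of_le hm with h | h
      · have := Polynomial.coeff_taylor_natDegree (r := (-1 : ℝ)) (f := p n)
        rw [Polynomial.leadingCoeff, hdeg n hn] at this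
        rw [← h, this, sub_self]
      · rw [Polynomial.coeff_eq_zero_of_natDegree_lt
            (by rw [Polynomial.natDegree_taylor, hdeg n hn]; exact h),
          Polynomial.coeff_eq_zero_of_natDegree_lt (by rw [hdeg n hn]; exact h), sub_self])
    have ho := horth n hn n hn
    rw [if_pos rfl] at ho
    refine Eq.trans ?_ ho
    rw [← sub_eq_zero, ← Finset.sum_sub_distrib, ← h0]
    refine Finset.sum_congr rfl fun k _ => ?_
    rw [Polynomial.eval_sub, hev]
    ring
  · intro n h1 hn
    have h0 := key n hn n le_rfl (Polynomial.taylor (-1) (p (n - 1))) (by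
      rw [Polynomial.degree_lt_iff_coeff_zero]
      intro m hm
      exact Polynomial.coeff_eq_zero_of_natDegree_lt
        (by rw [Polynomial.natDegree_taylor, hdeg (n - 1) (by omega)]; omega))
    simpa only [hev] using h0
end

section
/- Under hypotheses (i)–(iii), for all n ≥ 0 one has c²(t_n − n)·T_n·T_{n−1} = c·t_n² + cN·Σ_{j=0}^{n−1} T_j − c·t_n·Σ_{j=0}^{n−1} T_j − t_n(cN − 1 + α). -/
/-- Consequence of the compatibility relations (equation (4.2.2) in the paper). -/
theorem compatibility_eq_8
    (N : ℕ) (hN : 1 ≤ N) (α c : ℝ) (hc : c ≠ 0)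
    (t b : ℕ → ℝ) (T : ℤ → ℝ) (ht0 : t 0 = 0) (hTm1 : T (-1) = 0)
    (h1 : ∀ n : ℕ, c * (t n + t (n + 1) + b n * T (n : ℤ))
      = -1 + α + c * (N : ℝ) + c * ∑ j ∈ Finset.range (n + 1), T (j : ℤ))
    (h2 : ∀ n : ℕ, c * T (n : ℤ) - b n - 1 + α - c + (n : ℝ) = 0)
    (h3 : ∀ n : ℕ,
      c * (t (n + 1) - ((n : ℝ) + 1)) * T ((n : ℤ) + 1)
        - c * (t n - (n : ℝ)) * T ((n : ℤ) - 1)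
      = -(b n) * t (n + 1) + (b n - 1) * t n + (N : ℝ)) :
    ∀ n : ℕ, c ^ 2 * (t n - (n : ℝ)) * T (n : ℤ) * T ((n : ℤ) - 1)
      = c * (t n) ^ 2 + c * (N : ℝ) * ∑ j ∈ Finset.range n, T (j : ℤ)
        - c * t n * ∑ j ∈ Finset.range n, T (j : ℤ)
        - t n * (c * (N : ℝ) - 1 + α) := by
  intro n
  induction n with
  | zero => simp [ht0, hTm1]
  | succ k ih =>
    have e1 := h1 k
    have e3 := h3 k
    have hk : ((k + 1 : ℕ) : ℤ) - 1 = (k : ℤ) := by push_cast; ring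
    rw [Finset.sum_range_succ] at e1 ⊢
    rw [hk]
    push_cast
    linear_combination ih + c * T (k : ℤ) * e3 - (t (k + 1) - t k) * e1
end
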